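/- arXiv:2304.13432 — 8 statements merged into one kernel-verified Lean document; each statement's English description precedes it below -/
import Mathlib

section
/- Let m ≥ 1, let π be a permutation of F_2^m admitting a nonzero linear structure, i.e., there exist s ∈ F_2^m with s ≠ 0 and v ∈ F_2^m such that π(x) + π(x+s) = v for all x ∈ F_2^m, and let h : F_2^m → F_2 be an arbitrary Boolean function. Define g : F_2^m × F_2^m → F_2 by g(x,y) = x·π(y) + h(y). Then g has at least two distinct m-dimensional M-subspaces: F_2^m × {0} is an M-subspace of g, and so is V = span(W × {0} ∪ {(0,s)}), where W = {w ∈ F_2^m : w·v = 0}, and V ≠ F_2^m × {0}. -/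
open scoped BigOperators

/-- The vector space `F_2^n`. -/
abbrev BV (n : ℕ) := Fin n → ZMod 2

/-- Dot product on `F_2^n`. -/
def dotp {n : ℕ} (x y : BV n) : ZMod 2 := ∑ i, x i * y i

/-- `W` is an M-subspace of `f` : all second-order derivatives of `f` in directions
from `W` vanish identically. -/
def IsMSub {M : Type} [AddCommGroup M] [Module (ZMod 2) M] (f : M → ZMod 2)
    (W : Submodule (ZMod 2) M) : Prop :=
  ∀ a ∈ W, ∀ b ∈ W, ∀ x, f x + f (x + a) + f (x + b) + f (x + a + b) = 0

/-- A product of submodules is linearly equivalent to the product of the underlying modules. -/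
def submoduleProdEquiv {R M N : Type*} [Semiring R] [AddCommMonoid M] [AddCommMonoid N]
    [Module R M] [Module R N] (p : Submodule R M) (q : Submodule R N) :
    (p.prod q) ≃ₗ[R] p × q where
  toFun x := (⟨x.1.1, x.2.1⟩, ⟨x.1.2, x.2.2⟩)
  invFun x := ⟨(x.1.1, x.2.1), x.1.2, x.2.2⟩
  map_add' _ _ := rfl
  map_smul' _ _ := rfl
  left_inv _ := rfl
  right_inv _ := rfl

theorem finrank_submodule_prod {K M N : Type*} [Field K] [AddCommGroup M] [AddCommGroup N]
    [Module K M] [Module K N] [FiniteDimensional K M] [FiniteDimensional K N]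
    (p : Submodule K M) (q : Submodule K N) :
    Module.finrank K (p.prod q) = Module.finrank K p + Module.finrank K q := by
  rw [(submoduleProdEquiv p q).finrank_eq, Module.finrank_prod]

theorem span_inl_union_singleton {R M N : Type*} [Semiring R] [AddCommMonoid M]
    [AddCommMonoid N] [Module R M] [Module R N] (p : Submodule R M) (s : N) :
    Submodule.span R ({x : M × N | x.1 ∈ p ∧ x.2 = 0} ∪ {((0 : M), s)}) =
      p.prod (Submodule.span R {s}) := by
  apply le_antisymm
  · rw [Submodule.span_le]
    rintro ⟨a, b⟩ (⟨ha, hb⟩ | hab)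
    · obtain rfl : b = 0 := hb
      exact ⟨ha, zero_mem _⟩
    · obtain ⟨rfl, rfl⟩ := Prod.mk.inj hab
      exact ⟨zero_mem _, Submodule.mem_span_singleton_self _⟩
  · rintro ⟨a, b⟩ ⟨ha, hb⟩
    obtain ⟨c, rfl⟩ := Submodule.mem_span_singleton.1 hb
    have hsum : ((a, c • s) : M × N) = (a, 0) + c • (0, s) := by simp
    rw [hsum]
    exact add_mem (Submodule.subset_span (Or.inl ⟨ha, rfl⟩))
      (Submodule.smul_mem _ _ (Submodule.subset_span (Or.inr rfl)))

theorem dotp_add_left {n : ℕ} (x y z : BV n) : dotp (x + y) z = dotp x z + dotp y z :=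
  add_dotProduct x y z

theorem dotp_add_right {n : ℕ} (x y z : BV n) : dotp x (y + z) = dotp x y + dotp x z :=
  dotProduct_add x y z

/-- The linear functional `w ↦ w · v`. -/
def dotpLeft {n : ℕ} (v : BV n) : BV n →ₗ[ZMod 2] ZMod 2 where
  toFun w := dotp w v
  map_add' x y := dotp_add_left x y v
  map_smul' c x := smul_dotProduct c x v

theorem dotpLeft_ne_zero {n : ℕ} {v : BV n} (hv : v ≠ 0) : dotpLeft v ≠ 0 := fun h =>
  hv (dotProduct_eq_zero v fun w => (dotProduct_comm v w).trans (LinearMap.congr_fun h w))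

theorem isMSub_top_prod_bot {m : ℕ} {π : BV m → BV m} {h : BV m → ZMod 2}
    {g : BV m × BV m → ZMod 2} (hg : ∀ x y, g (x, y) = dotp x (π y) + h y) :
    IsMSub g ((⊤ : Submodule (ZMod 2) (BV m)).prod ⊥) := by
  rintro ⟨a, a'⟩ ⟨-, ha⟩ ⟨b, b'⟩ ⟨-, hb⟩ ⟨x, y⟩
  obtain rfl : a' = 0 := ha
  obtain rfl : b' = 0 := hb
  simp only [Prod.mk_add_mk, hg, dotp_add_left, add_zero]
  grind

theorem isMSub_ker_prod_span {m : ℕ} {π : BV m → BV m} {s v : BV m}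
    (hls : ∀ x, π x + π (x + s) = v) {h : BV m → ZMod 2}
    {g : BV m × BV m → ZMod 2} (hg : ∀ x y, g (x, y) = dotp x (π y) + h y) :
    IsMSub g ((LinearMap.ker (dotpLeft v)).prod (Submodule.span (ZMod 2) {s})) := by
  have mem_span {z : BV m} (hz : z ∈ Submodule.span (ZMod 2) {s}) : z = 0 ∨ z = s := by
    obtain ⟨c, rfl⟩ := Submodule.mem_span_singleton.1 hz
    fin_cases c
    · exact Or.inl (zero_smul _ s)
    · exact Or.inr (one_smul _ s)
  have dotp_shift (w y : BV m) : dotp w (π y) + dotp w (π (y + s)) = dotp w v := by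
    rw [← dotp_add_right, hls]
  rintro ⟨a, a'⟩ ⟨ha, ha'⟩ ⟨b, b'⟩ ⟨hb, hb'⟩ ⟨x, y⟩
  replace ha : dotp a v = 0 := ha
  replace hb : dotp b v = 0 := hb
  have hss : y + s + s = y := by rw [add_assoc, ZModModule.add_self, add_zero]
  have hxy := dotp_shift x y
  have hay := dotp_shift a y
  have hby := dotp_shift b y
  rcases mem_span ha' with rfl | rfl <;> rcases mem_span hb' with rfl | rfl <;>
    simp only [Prod.mk_add_mk, hg, dotp_add_left, add_zero, hss] <;> grind

theorem stmt0 {m : ℕ} (hm : 1 ≤ m) (π : BV m → BV m) (hπ : Function.Bijective π)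
    (s v : BV m) (hs : s ≠ 0) (hls : ∀ x, π x + π (x + s) = v)
    (h : BV m → ZMod 2)
    (g : BV m × BV m → ZMod 2) (hg : ∀ x y, g (x, y) = dotp x (π y) + h y)
    (U : Submodule (ZMod 2) (BV m × BV m))
    (hU : U = (⊤ : Submodule (ZMod 2) (BV m)).prod (⊥ : Submodule (ZMod 2) (BV m)))
    (V' : Submodule (ZMod 2) (BV m × BV m))
    (hV' : V' = Submodule.span (ZMod 2)
      ({p : BV m × BV m | dotp p.1 v = 0 ∧ p.2 = 0} ∪ {((0 : BV m), s)})) :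
    IsMSub g U ∧ Module.finrank (ZMod 2) ↥U = m ∧
      IsMSub g V' ∧ Module.finrank (ZMod 2) ↥V' = m ∧ V' ≠ U := by
  have hv : v ≠ 0 := by
    rintro rfl
    have hπs : π 0 = π s := by
      rw [← sub_eq_zero, ZModModule.sub_eq_add]
      simpa using hls 0
    exact hs (hπ.injective hπs).symm
  have hker := Module.Dual.finrank_ker_add_one_of_ne_zero (dotpLeft_ne_zero hv)
  rw [Module.finrank_fin_fun] at hker
  have hV : V' = (LinearMap.ker (dotpLeft v)).prod (Submodule.span (ZMod 2) {s}) :=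
    hV'.trans (span_inl_union_singleton (LinearMap.ker (dotpLeft v)) s)
  subst hU
  rw [hV]
  refine ⟨isMSub_top_prod_bot hg, ?_, isMSub_ker_prod_span hls hg, ?_, fun heq => hs ?_⟩
  · rw [finrank_submodule_prod, finrank_top, finrank_bot, Module.finrank_fin_fun, add_zero]
  · rw [finrank_submodule_prod, finrank_span_singleton hs, hker]
  · have hmem : ((0 : BV m), s) ∈ (⊤ : Submodule (ZMod 2) (BV m)).prod ⊥ :=
      heq ▸ ⟨zero_mem _, Submodule.mem_span_singleton_self s⟩
    exact hmem.2
end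

section
/- Let π be a permutation of F_2^m and let S be an (m−1)-dimensional subspace of F_2^m such that D_a D_b π is identically zero for all a, b ∈ S. Let s : F_2^m → F_2 be the nonzero linear Boolean function with s(y) = 0 if and only if y ∈ S. Then π is at most quadratic (all third-order derivatives D_a D_b D_c π vanish identically), and s or s+1 is a component function of π, i.e., there exists c ∈ F_2^m such that either c·π(y) = s(y) for all y ∈ F_2^m or c·π(y) = s(y) + 1 for all y ∈ F_2^m. -/
open scoped BigOperators

/-- A function to `F_2` that is flipped by some permutation of its finite domain vanishes on
exactly half of that domain. -/
theorem two_mul_card_zeros_of_flip {α : Type*} [Fintype α] (f : α → ZMod 2) (σ : α ≃ α)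
    (h : ∀ x, f (σ x) = f x + 1) :
    2 * (Finset.univ.filter fun x => f x = 0).card = Fintype.card α := by
  have key : ∀ u : ZMod 2, ¬ u = 0 ↔ u + 1 = 0 := by decide
  have hcard : (Finset.univ.filter fun x => ¬ f x = 0).card
      = (Finset.univ.filter fun x => f x = 0).card :=
    Finset.card_equiv σ fun x => by simp [h, key]
  have := Finset.card_filter_add_card_filter_not (s := (Finset.univ : Finset α)) (fun x => f x = 0)
  rw [hcard, Finset.card_univ] at this
  omega

/-- Two functions to `F_2` with equally many zeros agree if the zeros of one are zeros of
the other. -/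
theorem eq_of_zeros_subset {α : Type*} [Fintype α] (f g : α → ZMod 2)
    (hfg : ∀ x, f x = 0 → g x = 0)
    (hcard : (Finset.univ.filter fun x => f x = 0).card
      = (Finset.univ.filter fun x => g x = 0).card) (x : α) : g x = f x := by
  have hset : (Finset.univ.filter fun x => f x = 0) = Finset.univ.filter fun x => g x = 0 :=
    Finset.eq_of_subset_of_card_le (fun y hy => by simpa using hfg y (by simpa using hy)) hcard.ge
  have hx : f x = 0 ↔ g x = 0 := by simpa using Finset.ext_iff.mp hset x
  have key : ∀ u v : ZMod 2, (u = 0 ↔ v = 0) → v = u := by decide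
  exact key _ _ hx

/-- Every linear functional on `F_2^n` is a dot product. -/
theorem exists_dotp_eq {n : ℕ} (φ : BV n →ₗ[ZMod 2] ZMod 2) : ∃ c : BV n, ∀ y, dotp c y = φ y := by
  refine ⟨fun i => φ fun j => if i = j then 1 else 0, fun y => ?_⟩
  rw [φ.pi_apply_eq_sum_univ y]
  exact Finset.sum_congr rfl fun i _ => mul_comm _ _

theorem stmt1 {m : ℕ} (π : BV m → BV m) (hπ : Function.Bijective π)
    (S : Submodule (ZMod 2) (BV m)) (hSdim : Module.finrank (ZMod 2) ↥S = m - 1)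
    (hvan : ∀ a ∈ S, ∀ b ∈ S, ∀ x, π x + π (x + a) + π (x + b) + π (x + a + b) = 0)
    (s : BV m →ₗ[ZMod 2] ZMod 2) (hs0 : s ≠ 0)
    (hsS : ∀ y, s y = 0 ↔ y ∈ S) :
    (∀ a b c x : BV m,
      π x + π (x + a) + π (x + b) + π (x + c) + π (x + a + b) + π (x + a + c)
        + π (x + b + c) + π (x + a + b + c) = 0) ∧
    (∃ c : BV m, (∀ y, dotp c (π y) = s y) ∨ (∀ y, dotp c (π y) = s y + 1)) := by
  classical
  obtain ⟨e, he⟩ : ∃ e, s e = 1 := by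
    by_contra! hne
    have key : ∀ u : ZMod 2, u ≠ 1 → u = 0 := by decide
    exact hs0 (LinearMap.ext fun y => key _ (hne y))
  have hself : ∀ v : BV m, v + v = 0 := fun v => funext fun i => CharTwo.add_self_eq_zero (v i)
  have h2 : (2 : ZMod 2) = 0 := by decide
  let P : BV m →ₗ[ZMod 2] BV m := LinearMap.id + s.smulRight e
  have hP : ∀ y, P y = y + s y • e := fun y => rfl
  have hPS : ∀ y, P y ∈ S := fun y => (hsS _).1 (by
    rw [hP, map_add, map_smul, he, smul_eq_mul, mul_one]; exact CharTwo.add_self_eq_zero _)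
  have hadd : ∀ d x y, π (P (x + y) + d) + π d = (π (P x + d) + π d) + (π (P y + d) + π d) := by
    intro d x y
    have h := hvan _ (hPS x) _ (hPS y) d
    rw [map_add, show P x + P y + d = d + P x + P y by abel, add_comm (P x) d, add_comm (P y) d]
    ext i
    have h' := congrFun h i
    simp only [Pi.add_apply, Pi.zero_apply] at h' ⊢
    linear_combination h' - (π d i + π (d + P x) i + π (d + P y) i) * h2
  let F : BV m → BV m →+ BV m := fun d => AddMonoidHom.mk' (fun y => π (P y + d) + π d) (hadd d)
  have hF : ∀ d y, F d y = π (P y + d) + π d := fun d y => rfl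
  obtain ⟨p, q, hform⟩ : ∃ p q : BV m, ∀ y i,
      π y i = (1 + s y) * (p i + F 0 y i) + s y * (q i + F e y i) := by
    refine ⟨π 0, π e, fun y i => ?_⟩
    have key : ∀ u : ZMod 2, u = 0 ∨ u = 1 := by decide
    rcases key (s y) with h | h
    · have h0 : F 0 y = π y + π 0 := by rw [hF, hP, h, zero_smul, add_zero, add_zero]
      rw [h, h0, Pi.add_apply]
      linear_combination -(π 0 i) * h2
    · have he' : F e y = π y + π e := by rw [hF, hP, h, one_smul, add_assoc, hself, add_zero]
      rw [h, he', Pi.add_apply]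
      linear_combination -(π 0 i + F 0 y i + π e i) * h2
  refine ⟨fun a b c x => ?_, ?_⟩
  · ext i
    simp only [Pi.add_apply, Pi.zero_apply, hform, map_add]
    generalize s x = sx, s a = sa, s b = sb, s c = sc, p i = p, q i = q,
      F 0 x i = fx, F 0 a i = fa, F 0 b i = fb, F 0 c i = fc,
      F e x i = gx, F e a i = ga, F e b i = gb, F e c i = gc
    ring_nf
    reduce_mod_char
  · let L : BV m →ₗ[ZMod 2] BV m := (F 0).toZModLinearMap 2
    have hL : ∀ y, L y = π (P y + 0) + π 0 := fun y => rfl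
    have hLe : L e = 0 := by
      rw [hL, hP, he, one_smul, hself, add_zero, hself]
    have hrange : LinearMap.range L < ⊤ := by
      rw [lt_top_iff_ne_top, Ne, LinearMap.range_eq_top, ← LinearMap.injective_iff_surjective]
      intro hinj
      have : e = 0 := hinj (by rw [hLe, map_zero])
      simp [this] at he
    obtain ⟨φ, hφ0, hφ⟩ := Submodule.exists_le_ker_of_lt_top _ hrange
    obtain ⟨v, hv⟩ : ∃ v, φ v = 1 := by
      by_contra! hne
      have key : ∀ u : ZMod 2, u ≠ 1 → u = 0 := by decide
      exact hφ0 (LinearMap.ext fun y => key _ (hne y))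
    let p := Equiv.ofBijective π hπ
    have hp : ∀ y, π (p.symm y) = y := p.apply_symm_apply
    have hs_card := two_mul_card_zeros_of_flip s (Equiv.addRight e) fun x => by simp [he]
    have hφ_card := two_mul_card_zeros_of_flip (fun y => φ (π y) + φ (π 0))
      ((p.trans (Equiv.addRight v)).trans p.symm) fun x => by
        change φ (π (p.symm (π x + v))) + _ = _
        rw [hp, map_add, hv]
        ring
    have hzero : ∀ y, s y = 0 → φ (π y) + φ (π 0) = 0 := by
      intro y hy
      have h : φ (L y) = 0 := hφ ⟨y, rfl⟩
      rwa [hL, hP, hy, zero_smul, add_zero, add_zero, map_add] at h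
    have heq := eq_of_zeros_subset s (fun y => φ (π y) + φ (π 0)) hzero (by omega)
    obtain ⟨c, hc⟩ := exists_dotp_eq φ
    have key : ∀ u : ZMod 2, u = 0 ∨ u = 1 := by decide
    refine ⟨c, (key (φ (π 0))).imp (fun h y => ?_) fun h y => ?_⟩
    · rw [hc, ← heq y, h, add_zero]
    · rw [hc, ← heq y, h, add_assoc, CharTwo.add_self_eq_zero, add_zero]
end

section
/- Let π be a permutation of F_2^m with property (P1) such that, moreover, for every nonzero γ ∈ F_2^m the component function y ↦ γ·π(y) has no nonzero linear structures. Let h : F_2^m → F_2 be arbitrary and define f(x,y) = x·π(y) + h(y) on F_2^m × F_2^m. If S is a subspace of F_2^m × F_2^m with dim S ≥ 2 such that D_a D_b f = 0 for all a, b ∈ S, then S is a subspace of F_2^m × {0}. -/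
open scoped BigOperators

/-- Property (P1): the second-order derivative `D_v D_w π` is not identically zero for
all linearly independent `v, w` (over `F_2` : `v ≠ 0`, `w ≠ 0`, `v ≠ w`). -/
def P1 {m : ℕ} (π : BV m → BV m) : Prop :=
  ∀ v w : BV m, v ≠ 0 → w ≠ 0 → v ≠ w →
    ¬ ∀ x, π x + π (x + v) + π (x + w) + π (x + v + w) = 0

theorem dotp_zero_left {n : ℕ} (x : BV n) : dotp 0 x = 0 :=
  zero_dotProduct x

theorem eq_zero_of_forall_dotp {n : ℕ} {z : BV n} (hz : ∀ x, dotp x z = 0) : z = 0 :=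
  dotProduct_eq_zero z fun w => (dotProduct_comm z w).trans (hz w)

/-- If the second-order derivative of `x · π(y) + h(y)` in directions `a` and `b` vanishes, then so does
that of `π` in directions `a.2` and `b.2`. -/
theorem second_derivative_eq_zero {m : ℕ} {π : BV m → BV m} {h : BV m → ZMod 2}
    {f : BV m × BV m → ZMod 2} (hf : ∀ x y, f (x, y) = dotp x (π y) + h y)
    {a b : BV m × BV m} (hab : ∀ x, f x + f (x + a) + f (x + b) + f (x + a + b) = 0) (y : BV m) :
    π y + π (y + a.2) + π (y + b.2) + π (y + a.2 + b.2) = 0 := by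
  obtain ⟨a₁, a₂⟩ := a
  obtain ⟨b₁, b₂⟩ := b
  refine eq_zero_of_forall_dotp fun x => ?_
  have hx := hab (x, y)
  have h0 := hab (0, y)
  simp only [Prod.mk_add_mk, hf, dotp_add_left, dotp_add_right, dotp_zero_left] at hx h0 ⊢
  linear_combination hx - h0

/-- If the second-order derivative of `x · π(y) + h(y)` in directions `a` and `(c, 0)` vanishes,
then `a.2` is a linear structure of the component of `π` in direction `c`. -/
theorem component_derivative_eq_zero {m : ℕ} {π : BV m → BV m} {h : BV m → ZMod 2}
    {f : BV m × BV m → ZMod 2} (hf : ∀ x y, f (x, y) = dotp x (π y) + h y)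
    {a : BV m × BV m} {c : BV m}
    (hac : ∀ x, f x + f (x + a) + f (x + (c, 0)) + f (x + a + (c, 0)) = 0) (y : BV m) :
    dotp c (π (y + a.2)) + dotp c (π y) = 0 := by
  obtain ⟨a₁, a₂⟩ := a
  have h0 := hac (0, y)
  simp only [Prod.mk_add_mk, hf, dotp_add_left, dotp_zero_left, add_zero] at h0 ⊢
  linear_combination h0 - CharTwo.add_self_eq_zero (h y)
    - CharTwo.add_self_eq_zero (dotp a₁ (π (y + a₂)) + h (y + a₂))

theorem stmt4 {m : ℕ} (π : BV m → BV m) (hπ : Function.Bijective π) (hP1 : P1 π)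
    (hcomp : ∀ γ : BV m, γ ≠ 0 → ∀ a : BV m, a ≠ 0 →
      ¬ ∃ c : ZMod 2, ∀ x, dotp γ (π (x + a)) + dotp γ (π x) = c)
    (h : BV m → ZMod 2)
    (f : BV m × BV m → ZMod 2) (hf : ∀ x y, f (x, y) = dotp x (π y) + h y)
    (S : Submodule (ZMod 2) (BV m × BV m))
    (hSdim : 2 ≤ Module.finrank (ZMod 2) ↥S)
    (hSM : IsMSub f S) :
    S ≤ (⊤ : Submodule (ZMod 2) (BV m)).prod (⊥ : Submodule (ZMod 2) (BV m)) := by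
  rintro a ha
  refine ⟨trivial, by_contra fun ha2 : a.2 ≠ 0 => ?_⟩
  have hvert : ∀ b ∈ S, b.2 = 0 → b = 0 := by
    rintro ⟨c, d⟩ hb (rfl : d = 0)
    by_contra hc
    refine hcomp c (fun h0 => hc (by simp [h0])) a.2 ha2
      ⟨0, component_derivative_eq_zero hf (hSM a ha _ hb)⟩
  have hle : S ≤ Submodule.span (ZMod 2) {a} := by
    intro b hb
    by_cases hb2 : b.2 = 0
    · simp [hvert b hb hb2]
    by_cases hab : a.2 = b.2
    · have hsub : b - a = 0 := hvert _ (S.sub_mem hb ha) (by simp [hab])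
      rw [sub_eq_zero.mp hsub]
      exact Submodule.mem_span_singleton_self a
    · exact absurd (second_derivative_eq_zero hf (hSM a ha b hb)) (hP1 _ _ ha2 hb2 hab)
  have := (Submodule.finrank_mono hle).trans (finrank_span_singleton fun h0 => ha2 (by simp [h0])).le
  omega
end

section
/- Let π be a permutation of F_2^m of algebraic degree less than m−1, i.e., all (m−1)-th order derivatives D_{a_1}⋯D_{a_{m−1}} π vanish identically. Define f : F_2^m × F_2^m → F_2 by f(x,y) = x·π(y) + δ_0(y), where δ_0 is the indicator function of the zero vector. Then F_2^m × {0} is the unique m-dimensional M-subspace of f if and only if π has no nonzero linear structures. -/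
open scoped BigOperators

namespace BV

variable {m : ℕ}

theorem add_self (x : BV m) : x + x = 0 := by
  ext i
  exact CharTwo.add_self_eq_zero (x i)

theorem add_eq_zero_iff (x y : BV m) : x + y = 0 ↔ x = y := by
  refine ⟨fun h => ?_, fun h => h ▸ add_self y⟩
  calc x = x + (y + y) := by rw [add_self, add_zero]
    _ = (x + y) + y := by rw [add_assoc]
    _ = y := by rw [h, zero_add]

theorem dotp_eq_dotProduct (x y : BV m) : dotp x y = x ⬝ᵥ y := rfl

theorem dotp_sum {ι : Type*} (s : Finset ι) (u : BV m) (g : ι → BV m) :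
    dotp u (∑ i ∈ s, g i) = ∑ i ∈ s, dotp u (g i) := by
  simp only [dotp_eq_dotProduct, dotProduct_sum]

/-- Second-order derivative of a function of the form `x · π(y) + h(y)`. -/
theorem second_derivative_maioranaMcFarland (π : BV m → BV m) (h : BV m → ZMod 2)
    (f : BV m × BV m → ZMod 2) (hf : ∀ x y, f (x, y) = dotp x (π y) + h y)
    (x y u s v t : BV m) :
    f (x, y) + f ((x, y) + (u, s)) + f ((x, y) + (v, t)) + f ((x, y) + (u, s) + (v, t)) =
      dotp x (π y + π (y + s) + π (y + t) + π (y + s + t)) +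
      dotp u (π (y + s) + π (y + s + t)) + dotp v (π (y + t) + π (y + s + t)) +
      (h y + h (y + s) + h (y + t) + h (y + s + t)) := by
  simp only [Prod.mk_add_mk, hf, dotp_eq_dotProduct, add_dotProduct, dotProduct_add]
  ring

end BV

theorem Fin.sum_finset_succ {k : ℕ} {M N : Type*} [AddCommMonoid M] [AddCommMonoid N]
    (g : M → N) (t : M) (c : Fin k → M) :
    ∑ T : Finset (Fin (k + 1)), g (∑ i ∈ T, (Fin.cons t c : Fin (k + 1) → M) i) =
      ∑ T : Finset (Fin k), (g (∑ i ∈ T, c i) + g (t + ∑ i ∈ T, c i)) := by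
  classical
  have h0 : (0 : Fin (k + 1)) ∉ Finset.univ.map (Fin.succEmb k) := by simp
  have huniv : (Finset.univ : Finset (Fin (k + 1))) =
      insert 0 (Finset.univ.map (Fin.succEmb k)) := by
    ext i
    cases i using Fin.cases <;> simp
  have himg : (Finset.univ.map (Fin.succEmb k)).powerset =
      (Finset.univ : Finset (Finset (Fin k))).map
        (Finset.mapEmbedding (Fin.succEmb k)).toEmbedding := by
    ext T
    simp only [Finset.mem_powerset, Finset.mem_map, Finset.mem_univ, true_and,
      Finset.subset_map_iff, Finset.subset_univ]
    exact ⟨fun ⟨a, h⟩ => ⟨a, h.symm⟩, fun ⟨a, h⟩ => ⟨a, h.symm⟩⟩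
  rw [← Finset.powerset_univ, huniv, Finset.sum_powerset_insert h0, himg, Finset.sum_map,
    Finset.sum_map, ← Finset.sum_add_distrib]
  refine Finset.sum_congr rfl fun T _ => ?_
  have hT : (0 : Fin (k + 1)) ∉ T.map (Fin.succEmb k) := by simp
  simp only [RelEmbedding.coe_toEmbedding, Finset.mapEmbedding_apply]
  rw [Finset.sum_insert hT]
  simp [Finset.sum_map]

theorem LinearIndependent.exists_cons_cons {K V : Type*} [DivisionRing K] [AddCommGroup V]
    [Module K V] {s t : V} (hst : LinearIndependent K ![s, t]) {k : ℕ}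
    (hk : k + 2 ≤ Module.finrank K V) :
    ∃ c : Fin k → V,
      LinearIndependent K (Fin.cons s (Fin.cons t c : Fin (k + 1) → V) : Fin (k + 2) → V) := by
  induction k with
  | zero =>
    refine ⟨Fin.elim0, ?_⟩
    convert hst using 1
    ext i
    fin_cases i <;> rfl
  | succ k ih =>
    obtain ⟨c, hc⟩ := ih (by omega)
    obtain ⟨x, hx⟩ := exists_linearIndependent_snoc_of_lt_finrank hc (by omega)
    exact ⟨Fin.snoc c x, by rwa [Fin.cons_snoc_eq_snoc_cons, Fin.cons_snoc_eq_snoc_cons]⟩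

theorem LinearIndependent.sum_delta_zero_finset {m k : ℕ} {c : Fin k → BV m}
    (hc : LinearIndependent (ZMod 2) c) :
    ∑ T : Finset (Fin k), (if ∑ i ∈ T, c i = 0 then 1 else 0 : ZMod 2) = 1 := by
  rw [Finset.sum_eq_single ∅]
  · simp
  · intro T _ hT
    refine if_neg fun h => hT ?_
    by_contra hne
    obtain ⟨i, hi⟩ := Finset.nonempty_iff_ne_empty.mpr hne
    exact one_ne_zero
      (linearIndependent_iff'.mp hc T (fun _ => 1) (by simpa using h) i hi)
  · simp

theorem Submodule.finrank_prod_eq {K V V' : Type*} [Field K] [AddCommGroup V] [Module K V]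
    [AddCommGroup V'] [Module K V'] [FiniteDimensional K V] [FiniteDimensional K V']
    (p : Submodule K V) (q : Submodule K V') :
    Module.finrank K (p.prod q) = Module.finrank K p + Module.finrank K q := by
  have h : p.prod q = LinearMap.range (p.subtype.prodMap q.subtype) := by
    rw [LinearMap.range_prodMap, Submodule.range_subtype, Submodule.range_subtype]
  rw [h, LinearMap.finrank_range_of_inj, Module.finrank_prod]
  exact Function.Injective.prodMap p.injective_subtype q.injective_subtype

namespace BV

variable {m : ℕ}

theorem linearIndependent_pair {s t : BV m} (hs : s ≠ 0) (ht : t ≠ 0) (hst : s ≠ t) :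
    LinearIndependent (ZMod 2) ![s, t] := by
  rw [LinearIndependent.pair_iff' hs]
  intro a
  have hcases : ∀ c : ZMod 2, c = 0 ∨ c = 1 := by decide
  obtain rfl | rfl := hcases a
  · simpa using ht.symm
  · simpa using hst

theorem exists_constant_derivative_of_mem {π : BV m → BV m} (hπ : Function.Injective π)
    {a : BV m} (ha : a ≠ 0) (K : Submodule (ZMod 2) (BV m))
    (hK : m ≤ Module.finrank (ZMod 2) K + 1)
    (horth : ∀ u ∈ K, ∀ y, dotp u (π (y + a) + π y) = 0) :
    ∃ c : BV m, ∀ y, π (y + a) + π y = c := by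
  have hle : Module.finrank (ZMod 2) K.dualAnnihilator ≤ 1 := by
    have h := Subspace.finrank_add_finrank_dualAnnihilator_eq K
    rw [Module.finrank_fin_fun] at h
    omega
  obtain ⟨v, hv⟩ := finrank_le_one_iff.mp hle
  have key : ∀ y, dotProductEquiv (ZMod 2) (Fin m) (π (y + a) + π y) = v := by
    intro y
    have hmem : dotProductEquiv (ZMod 2) (Fin m) (π (y + a) + π y) ∈ K.dualAnnihilator := by
      rw [Submodule.mem_dualAnnihilator]
      intro u hu
      have h := horth u hu y
      rw [dotp_eq_dotProduct, dotProduct_comm] at h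
      exact h
    obtain ⟨c, hc⟩ := hv ⟨_, hmem⟩
    have hc' : c • (v : Module.Dual (ZMod 2) (BV m)) =
      dotProductEquiv (ZMod 2) (Fin m) (π (y + a) + π y) := congrArg Subtype.val hc
    have hne : π (y + a) + π y ≠ 0 := fun h =>
      ha (by simpa using hπ ((add_eq_zero_iff _ _).mp h))
    rw [← hc']
    have hcases : ∀ c : ZMod 2, c = 0 ∨ c = 1 := by decide
    obtain rfl | rfl := hcases c
    · rw [zero_smul, eq_comm, LinearEquiv.map_eq_zero_iff] at hc'
      exact absurd hc' hne
    · rw [one_smul]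
  exact ⟨(dotProductEquiv (ZMod 2) (Fin m)).symm v, fun y => by
    rw [← key y, LinearEquiv.symm_apply_apply]⟩

/-- Two directions of an M-subspace of `x · π(y) + δ₀(y)` cannot have linearly independent
second components when `π` has degree less than `m - 1`. -/
theorem not_linearIndependent_snd {π : BV m → BV m}
    (hdeg : ∀ a : Fin (m - 1) → BV m, ∀ x : BV m,
      ∑ T : Finset (Fin (m - 1)), π (x + ∑ i ∈ T, a i) = 0)
    {u s v t : BV m}
    (hDD : ∀ x y, dotp x (π y + π (y + s) + π (y + t) + π (y + s + t)) +
      dotp u (π (y + s) + π (y + s + t)) + dotp v (π (y + t) + π (y + s + t)) +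
      ((if y = 0 then 1 else 0) + (if y + s = 0 then 1 else 0) + (if y + t = 0 then 1 else 0) +
        (if y + s + t = 0 then 1 else 0)) = 0) :
    ¬ LinearIndependent (ZMod 2) ![s, t] := by
  intro hst
  have hm : 2 ≤ m := by simpa using hst.fintype_card_le_finrank
  obtain ⟨k, rfl⟩ := Nat.exists_eq_add_of_le' hm
  obtain ⟨c, hc⟩ := hst.exists_cons_cons (k := k) (by simp)
  have hdeg' : ∀ (r x : BV (k + 2)),
      ∑ T : Finset (Fin k), (π (x + ∑ i ∈ T, c i) + π (x + (r + ∑ i ∈ T, c i))) = 0 := by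
    intro r x
    rw [← Fin.sum_finset_succ (fun z => π (x + z)) r c]
    exact hdeg (Fin.cons r c : Fin (k + 1) → BV (k + 2)) x
  have hdelta := hc.sum_delta_zero_finset
  rw [Fin.sum_finset_succ (fun z : BV (k + 2) => (if z = 0 then 1 else 0 : ZMod 2)),
    Fin.sum_finset_succ (fun z : BV (k + 2) => (if z = 0 then 1 else 0 : ZMod 2) +
      (if s + z = 0 then 1 else 0))] at hdelta
  have h1 := congrArg (dotp u) (hdeg' t s)
  have h2 := congrArg (dotp v) (hdeg' s t)
  rw [dotp_sum] at h1 h2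
  have h0 : ∀ w : BV (k + 2), dotp w 0 = 0 := fun w => dotProduct_zero w
  rw [h0] at h1 h2
  have hz : ∀ z : BV (k + 2),
      (if z = 0 then 1 else 0 : ZMod 2) + (if s + z = 0 then 1 else 0) +
        ((if t + z = 0 then 1 else 0) + (if s + (t + z) = 0 then 1 else 0)) =
      dotp u (π (s + z) + π (s + (t + z))) + dotp v (π (t + z) + π (t + (s + z))) := by
    intro z
    have h := hDD 0 z
    rw [dotp_eq_dotProduct, zero_dotProduct, zero_add, CharTwo.add_eq_zero] at h
    rw [add_left_comm t s z, ← add_assoc s t z, add_comm s t, add_assoc t s z,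
      add_comm s z, add_comm t z, add_comm t (z + s), h]
    ring
  rw [Finset.sum_congr rfl fun T _ => hz _, Finset.sum_add_distrib, h1, h2, add_zero] at hdelta
  exact zero_ne_one hdelta

end BV

theorem stmt5 {m : ℕ} (π : BV m → BV m) (hπ : Function.Bijective π)
    (hdeg : ∀ a : Fin (m - 1) → BV m, ∀ x : BV m,
      ∑ T : Finset (Fin (m - 1)), π (x + ∑ i ∈ T, a i) = 0)
    (f : BV m × BV m → ZMod 2)
    (hf : ∀ x y, f (x, y) = dotp x (π y) + (if y = 0 then 1 else 0))
    (U : Submodule (ZMod 2) (BV m × BV m))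
    (hU : U = (⊤ : Submodule (ZMod 2) (BV m)).prod (⊥ : Submodule (ZMod 2) (BV m))) :
    (IsMSub f U ∧ ∀ W : Submodule (ZMod 2) (BV m × BV m),
        Module.finrank (ZMod 2) ↥W = m → IsMSub f W → W = U) ↔
      (∀ a : BV m, a ≠ 0 → ¬ ∃ c : BV m, ∀ x, π (x + a) + π x = c) := by
  have hDD := BV.second_derivative_maioranaMcFarland π (fun y => if y = 0 then 1 else 0) f hf
  have hd0 : ∀ w : BV m, dotp w 0 = 0 := fun w => dotProduct_zero w
  have hself : ∀ x : ZMod 2, x + x = 0 := CharTwo.add_self_eq_zero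
  have hUrank : Module.finrank (ZMod 2) U = m := by
    rw [hU, Submodule.finrank_prod_eq]
    simp
  constructor
  · rintro ⟨-, huniq⟩ a ha ⟨c, hc⟩
    have hc0 : c ≠ 0 := fun h => ha <| by
      have h0 := hc 0
      rw [h, BV.add_eq_zero_iff, zero_add] at h0
      exact hπ.injective h0
    have hφ : dotProductEquiv (ZMod 2) (Fin m) c ≠ 0 := by simpa using hc0
    have hrank := Module.Dual.finrank_ker_add_one_of_ne_zero hφ
    rw [Module.finrank_fin_fun] at hrank
    have hW := huniq
      ((LinearMap.ker (dotProductEquiv (ZMod 2) (Fin m) c)).prod (Submodule.span (ZMod 2) {a}))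
      (by rw [Submodule.finrank_prod_eq, finrank_span_singleton ha, hrank]) ?_
    · have hmem : ((0 : BV m), a) ∈ U := by
        rw [← hW]
        exact ⟨zero_mem _, Submodule.mem_span_singleton_self a⟩
      rw [hU] at hmem
      exact ha hmem.2
    · have hspan : ∀ s ∈ Submodule.span (ZMod 2) {a}, s = 0 ∨ s = a := by
        intro s hs
        obtain ⟨r, rfl⟩ := Submodule.mem_span_singleton.mp hs
        have hcases : ∀ c : ZMod 2, c = 0 ∨ c = 1 := by decide
        obtain rfl | rfl := hcases r
        · simp
        · simp
      have hker : ∀ u ∈ LinearMap.ker (dotProductEquiv (ZMod 2) (Fin m) c), dotp u c = 0 := by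
        intro u hu
        rw [BV.dotp_eq_dotProduct, dotProduct_comm]
        exact hu
      rintro ⟨u, s⟩ ⟨hu, hs⟩ ⟨v, t⟩ ⟨hv, ht⟩ ⟨x, y⟩
      have hcy : ∀ y, π y + π (y + a) = c := fun y => by rw [add_comm, hc]
      have hu' := hker u hu
      have hv' := hker v hv
      rw [hDD]
      have hyaa : y + a + a = y := by rw [add_assoc, BV.add_self, add_zero]
      have hcy' : π (y + a) + π y = c := hc y
      have hc3 : c + π y + π (y + a) = 0 := by rw [add_assoc, hcy, BV.add_self]
      have hc3' : c + π (y + a) + π y = 0 := by rw [add_assoc, hcy', BV.add_self]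
      obtain hs0 | hs0 := hspan s hs <;> obtain ht0 | ht0 := hspan t ht <;>
        simp only [hs0, ht0, add_zero, hyaa, BV.add_self, hd0, zero_add, hcy, hcy', hc3, hc3',
          hu', hv'] <;>
        grind
  · intro hlin
    refine ⟨?_, fun W hWrank hWM => ?_⟩
    · rw [hU]
      rintro ⟨u, s⟩ ⟨-, hs⟩ ⟨v, t⟩ ⟨-, ht⟩ ⟨x, y⟩
      obtain rfl : s = 0 := hs
      obtain rfl : t = 0 := ht
      rw [hDD]
      simp [BV.add_self, hd0, hself]
    · by_cases hY : ∀ w ∈ W, w.2 = 0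
      · refine Submodule.eq_of_le_of_finrank_eq (fun w hw => ?_) (hWrank.trans hUrank.symm)
        rw [hU]
        exact ⟨Submodule.mem_top, hY w hw⟩
      exfalso
      push Not at hY
      obtain ⟨⟨v, a⟩, hva, ha⟩ := hY
      have hY' : ∀ w ∈ W, w.2 = 0 ∨ w.2 = a := by
        rintro ⟨u, s⟩ hus
        by_contra! h
        exact BV.not_linearIndependent_snd hdeg
          (fun x y => (hDD x y u s v a).symm.trans (hWM _ hus _ hva _))
          (BV.linearIndependent_pair h.1 ha h.2)
      let K : Submodule (ZMod 2) (BV m) := W.comap (LinearMap.inl (ZMod 2) (BV m) (BV m))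
      refine hlin a ha (BV.exists_constant_derivative_of_mem hπ.injective ha K ?_ ?_)
      · have hle : W ≤ K.map (LinearMap.inl (ZMod 2) (BV m) (BV m)) ⊔
            Submodule.span (ZMod 2) {(v, a)} := by
          rintro ⟨u, s⟩ hus
          obtain h | h := hY' _ hus
          · obtain rfl : s = 0 := h
            exact Submodule.mem_sup_left ⟨u, hus, rfl⟩
          · obtain rfl : s = a := h
            refine Submodule.mem_sup.mpr ⟨(u + v, 0), ⟨u + v, ?_, rfl⟩, (v, s),
              Submodule.mem_span_singleton_self _, ?_⟩
            · have := W.add_mem hus hva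
              rw [Prod.mk_add_mk, BV.add_self] at this
              exact this
            · simp [add_assoc, BV.add_self]
        have h1 := Submodule.finrank_mono hle
        have h2 := Submodule.finrank_add_le_finrank_add_finrank
          (K.map (LinearMap.inl (ZMod 2) (BV m) (BV m))) (Submodule.span (ZMod 2) {(v, a)})
        have h3 := Submodule.finrank_map_le (LinearMap.inl (ZMod 2) (BV m) (BV m)) K
        have h4 : Module.finrank (ZMod 2) (Submodule.span (ZMod 2) {(v, a)}) = 1 :=
          finrank_span_singleton fun h => ha (congrArg Prod.snd h)
        omega
      · intro u hu y
        have h := hWM _ hu _ hva (0, y)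
        rw [LinearMap.inl_apply, hDD] at h
        simp [hd0, BV.add_self] at h
        rw [add_comm (π (y + a))]
        grind
end

section
/- Let π be an at most quadratic permutation of F_2^m, i.e., all third-order derivatives D_a D_b D_c π of π vanish identically. Then π has property (P1) if and only if π is an APN permutation of F_2^m. -/
open scoped BigOperators

theorem BV.add_self_s7 {n : ℕ} (x : BV n) : x + x = 0 := by
  funext i
  exact CharTwo.add_self_eq_zero (x i)

theorem BV.eq_of_add_eq_zero {n : ℕ} {x y : BV n} (h : x + y = 0) : x = y := by
  have hy := BV.add_self_s7 y
  grind

/-- If all third-order derivatives of `f` vanish, then a second-order derivative that vanishes at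
one point vanishes identically. -/
theorem BV.second_derivative_eq_zero {m n : ℕ} {f : BV m → BV n}
    (hquad : ∀ a b c x : BV m,
      f x + f (x + a) + f (x + b) + f (x + c) + f (x + a + b) + f (x + a + c)
        + f (x + b + c) + f (x + a + b + c) = 0)
    {v w x : BV m} (hx : f x + f (x + v) + f (x + w) + f (x + v + w) = 0) (y : BV m) :
    f y + f (y + v) + f (y + w) + f (y + v + w) = 0 := by
  have hxy : x + (x + y) = y := by rw [← add_assoc, BV.add_self_s7, zero_add]
  have h := hquad v w (x + y) x
  rw [show x + v + (x + y) = x + (x + y) + v by abel,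
    show x + w + (x + y) = x + (x + y) + w by abel,
    show x + v + w + (x + y) = x + (x + y) + v + w by abel, hxy] at h
  grind

theorem stmt7 {m : ℕ} (π : BV m → BV m) (hπ : Function.Bijective π)
    (hquad : ∀ a b c x : BV m,
      π x + π (x + a) + π (x + b) + π (x + c) + π (x + a + b) + π (x + a + c)
        + π (x + b + c) + π (x + a + b + c) = 0) :
    (∀ v w : BV m, v ≠ 0 → w ≠ 0 → v ≠ w →
        ¬ ∀ x, π x + π (x + v) + π (x + w) + π (x + v + w) = 0) ↔
      (∀ a : BV m, a ≠ 0 → ∀ b : BV m, {x : BV m | π (x + a) + π x = b}.ncard ≤ 2) := by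
  constructor
  · intro hP a ha b
    by_contra! hcard
    obtain ⟨x, hx⟩ : {x : BV m | π (x + a) + π x = b}.Nonempty :=
      Set.nonempty_of_ncard_ne_zero (by omega)
    obtain ⟨y, hy, hyx⟩ := Set.exists_mem_notMem_of_ncard_lt_ncard
      (show ({x, x + a} : Set (BV m)).ncard < _ from
        ((Set.ncard_insert_le _ _).trans_eq (by rw [Set.ncard_singleton])).trans_lt hcard)
    simp only [Set.mem_insert_iff, Set.mem_singleton_iff, not_or] at hyx
    simp only [Set.mem_ofPred_eq] at hx hy
    have hxy : x + (x + y) = y := by rw [← add_assoc, BV.add_self_s7, zero_add]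
    refine hP a (x + y) ha (fun h => hyx.1 (BV.eq_of_add_eq_zero h).symm)
      (fun h => hyx.2 (by rw [h, hxy])) (BV.second_derivative_eq_zero hquad (x := x) ?_)
    rw [show x + a + (x + y) = x + (x + y) + a by abel, hxy]
    have hb := BV.add_self_s7 b
    grind
  · intro hA v w hv hw hvw hzero
    have h0 := hzero 0
    simp only [zero_add] at h0
    have hsub : ({0, v, w} : Set (BV m)) ⊆ {x : BV m | π (x + v) + π x = π v + π 0} := by
      rintro x (rfl | rfl | rfl)
      · simp
      · simp [BV.add_self_s7, add_comm]
      · rw [Set.mem_ofPred_eq, add_comm x v]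
        exact BV.eq_of_add_eq_zero (Eq.trans (by abel) h0)
    have hle := (Set.ncard_le_ncard hsub).trans (hA v hv (π v + π 0))
    rw [Set.ncard_eq_three.mpr ⟨0, v, w, hv.symm, hw.symm, hvw, rfl⟩] at hle
    omega
end

section
/- Let m = 2r with r ≥ 3 odd, let t ≥ 1 be an integer with gcd(t,m) = 2, and let π : F_{2^m} → F_{2^m} be given by π(y) = y^{2^t+1} (which is a permutation of F_{2^m}). Regard F_{2^m} as a vector space over F_2 and let Tr denote the absolute trace from F_{2^m} to F_2. Then: (a) every F_2-subspace S of F_{2^m} such that D_a D_b π is identically zero for all a, b ∈ S satisfies dim_{F_2} S ≤ 2; (b) π has property (P2): for every F_2-subspace S of F_{2^m} with dim_{F_2} S ≥ 1 such that D_a D_b π is identically zero for all a, b ∈ S, setting k = m − dim_{F_2} S, there do not exist F_2-linearly independent elements u_1, …, u_k ∈ F_{2^m} with Tr(u_i · (π(y+a) + π(y))) = 0 for all a ∈ S, all y ∈ F_{2^m} and all i = 1, …, k. -/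
open scoped BigOperators

/-- Exponents `2 ^ i` and `2 ^ j` fixing `x` combine to the exponent `2 ^ gcd i j`. -/
theorem pow_two_pow_gcd_eq_self {M : Type*} [Monoid M] {x : M} {i j : ℕ}
    (hi : x ^ 2 ^ i = x) (hj : x ^ 2 ^ j = x) : x ^ 2 ^ Nat.gcd i j = x := by
  have key (n : ℕ) : Function.IsPeriodicPt (fun z : M => z ^ 2) n x ↔ x ^ 2 ^ n = x := by
    rw [Function.IsPeriodicPt, Function.IsFixedPt, pow_iterate]
  exact (key _).1 (((key _).2 hi).gcd ((key _).2 hj))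

/-- Elements that are pairwise proportional over the field with four elements span a space of
dimension at most two. -/
theorem finrank_le_two_of_mul_pow_comm {F : Type*} [Field F] [Fintype F] [Algebra (ZMod 2) F]
    {n t : ℕ} (hcard : Fintype.card F = 2 ^ n) (hgcd : Nat.gcd t n = 2)
    (S : Submodule (ZMod 2) F) (hS : ∀ a ∈ S, ∀ b ∈ S, a * b ^ 2 ^ t = b * a ^ 2 ^ t) :
    Module.finrank (ZMod 2) S ≤ 2 := by
  classical
  by_cases hbot : S = ⊥
  · subst hbot
    simp
  obtain ⟨a, ha, ha0⟩ := S.exists_mem_ne_zero_of_ne_bot hbot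
  let p : Polynomial F := Polynomial.X ^ 4 - Polynomial.X
  have hp : p.natDegree = 4 := FiniteField.X_pow_card_sub_X_natDegree_eq F (by norm_num)
  have hp0 : p ≠ 0 := FiniteField.X_pow_card_sub_X_ne_zero F (by norm_num)
  have hroot (b : S) : (b : F) / a ∈ p.roots.toFinset := by
    have h1 : ((b : F) / a) ^ 2 ^ t = b / a := by
      rw [div_pow, div_eq_div_iff (pow_ne_zero _ ha0) ha0, mul_comm]
      exact hS a ha b b.2
    have h2 : ((b : F) / a) ^ 2 ^ n = b / a := by
      rw [← hcard, FiniteField.pow_card]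
    have h3 := pow_two_pow_gcd_eq_self h1 h2
    rw [hgcd] at h3
    rw [Multiset.mem_toFinset, Polynomial.mem_roots hp0]
    simpa [p, sub_eq_zero] using h3
  have hle : Fintype.card S ≤ 4 := by
    calc Fintype.card S = (Finset.univ : Finset S).card := rfl
      _ ≤ p.roots.toFinset.card :=
        Finset.card_le_card_of_injOn (fun b : S => (b : F) / a) (fun b _ => hroot b)
          (fun b _ c _ h => Subtype.ext ((div_left_inj' ha0).1 h))
      _ ≤ p.roots.card := Multiset.toFinset_card_le _
      _ ≤ 4 := hp ▸ p.card_roots'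
  rw [Module.card_eq_pow_finrank (K := ZMod 2), ZMod.card] at hle
  exact (Nat.pow_le_pow_iff_right (by norm_num)).1 (hle.trans (by norm_num : 4 ≤ 2 ^ 2))

/-- The absolute trace is invariant under iterates of the Frobenius. -/
theorem trace_pow_two_pow {F : Type*} [Field F] [Finite F] [Algebra (ZMod 2) F] (x : F) (n : ℕ) :
    Algebra.trace (ZMod 2) F (x ^ 2 ^ n) = Algebra.trace (ZMod 2) F x := by
  induction n with
  | zero => simp
  | succ n ih =>
    rw [← ih, ← Algebra.trace_eq_of_algEquiv
      (FiniteField.frobeniusAlgEquivOfAlgebraic (ZMod 2) F) (x ^ 2 ^ n),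
      FiniteField.frobeniusAlgEquivOfAlgebraic_apply, ZMod.card, pow_succ, pow_mul]

/-- Nondegeneracy of the trace form over the field with two elements. -/
theorem eq_zero_of_trace_mul_eq_zero {F : Type*} [Field F] [Finite F] [Algebra (ZMod 2) F] {c : F}
    (h : ∀ y, Algebra.trace (ZMod 2) F (c * y) = 0) : c = 0 :=
  (traceForm_nondegenerate (ZMod 2) F).1 c fun y => by rw [Algebra.traceForm_apply, h]

/-- The additive polynomial equation satisfied by `u` when the trace form of `u` times the
derivative of the Gold function in direction `a` vanishes. -/
theorem pow_mul_pow_eq_of_trace_eq_zero {F : Type*} [Field F] [Finite F] [Algebra (ZMod 2) F]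
    {t : ℕ} {u a : F}
    (h : ∀ y, Algebra.trace (ZMod 2) F (u * ((y + a) ^ (2 ^ t + 1) + y ^ (2 ^ t + 1))) = 0) :
    u ^ 2 ^ t * (a ^ 2 ^ t) ^ 2 ^ t = u * a := by
  have : CharP F 2 := charP_of_injective_algebraMap (algebraMap (ZMod 2) F).injective 2
  have : PerfectRing F 2 := PerfectRing.ofFiniteOfIsReduced 2 F
  have h2 : (2 : F) = 0 := CharTwo.two_eq_zero
  have h0 : Algebra.trace (ZMod 2) F (u * (a * a ^ 2 ^ t)) = 0 := by
    simpa [pow_succ, mul_comm] using h 0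
  rw [← sub_eq_zero]
  refine eq_zero_of_trace_mul_eq_zero fun z => ?_
  obtain ⟨y, rfl⟩ := (iterateFrobeniusEquiv F 2 t).surjective z
  rw [iterateFrobeniusEquiv_def]
  have e1 : u * ((y + a) ^ (2 ^ t + 1) + y ^ (2 ^ t + 1)) =
      u * a ^ 2 ^ t * y + u * a * y ^ 2 ^ t + u * (a * a ^ 2 ^ t) := by
    rw [pow_succ, pow_succ, add_pow_char_pow]
    linear_combination u * y ^ 2 ^ t * y * h2
  have e2 := h y
  rw [e1, map_add, h0, add_zero, map_add, ← trace_pow_two_pow (u * a ^ 2 ^ t * y) t, ← map_add] at e2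
  rw [← e2]
  congr 1
  rw [mul_pow, mul_pow]
  linear_combination -u * a * y ^ 2 ^ t * h2

/-- The Gold function is injective when `gcd(t, 2r) = 2` and `r` is odd. -/
theorem pow_two_pow_add_one_injective {F : Type*} [Field F] [Fintype F] {r t : ℕ} (hodd : Odd r)
    (hgcd : Nat.gcd t (2 * r) = 2) (hcard : Fintype.card F = 2 ^ (2 * r)) [CharP F 2] :
    Function.Injective fun y : F => y ^ (2 ^ t + 1) := by
  intro x y hxy
  simp only at hxy
  by_cases hy : y = 0
  · subst hy
    rw [zero_pow (Nat.succ_ne_zero _)] at hxy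
    exact eq_zero_of_pow_eq_zero hxy
  have hz : (x / y) ^ (2 ^ t + 1) = 1 := by
    rw [div_pow, hxy, div_self (pow_ne_zero _ hy)]
  generalize hzdef : x / y = z at hz
  have hz0 : z ≠ 0 := by
    rintro rfl
    simp at hz
  have h1 : z ^ 2 ^ t = z⁻¹ := eq_inv_of_mul_eq_one_left (by rwa [← pow_succ])
  have h2 : z ^ 2 ^ (2 * t) = z := by
    rw [two_mul, pow_add, pow_mul, h1, inv_pow, h1, inv_inv]
  have h3 : z ^ 2 ^ (2 * r) = z := by rw [← hcard, FiniteField.pow_card]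
  have ht2 : 2 ∣ t := hgcd ▸ Nat.gcd_dvd_left t (2 * r)
  have hg : Nat.gcd (2 * t) (2 * r) = 2 := by
    rw [Nat.gcd_mul_left]
    have hd : Nat.gcd t r ∣ 2 := by
      rw [← hgcd]
      exact Nat.gcd_dvd_gcd_mul_left_right t r 2
    rcases (Nat.dvd_prime Nat.prime_two).1 hd with h | h
    · rw [h]
    · have : 2 ∣ r := h ▸ Nat.gcd_dvd_right t r
      exact absurd hodd (Nat.not_odd_iff_even.2 (even_iff_two_dvd.2 this))
  have h4 := pow_two_pow_gcd_eq_self h2 h3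
  rw [hg] at h4
  have h5 : z ^ 2 ^ t = z := by
    obtain ⟨k, rfl⟩ := ht2
    clear h1 h2 hgcd hg hxy hz
    induction k with
    | zero => simp
    | succ k ih => rw [mul_add, mul_one, pow_add, pow_mul, ih, h4]
  have h6 : z ^ 2 = 1 := by
    rw [sq]
    nth_rw 1 [← h5]
    rw [h1, inv_mul_cancel₀ hz0]
  have h7 : z = 1 := by
    have : (z - 1) ^ 2 = 0 := by
      linear_combination h6 + (1 - z) * (CharTwo.two_eq_zero : (2 : F) = 0)
    exact sub_eq_zero.1 (eq_zero_of_pow_eq_zero this)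
  exact (div_eq_one_iff_eq hy).1 (hzdef.trans h7)

/-- The solutions `u` of `u ^ (2 ^ t) * c = u * d`, as a subspace over the prime field. -/
def powMulEqSubmodule {F : Type*} [Field F] [Algebra (ZMod 2) F] [CharP F 2] (t : ℕ) (c d : F) :
    Submodule (ZMod 2) F where
  carrier := {u | u ^ 2 ^ t * c = u * d}
  zero_mem' := by simp
  add_mem' {u v} hu hv := by
    simp only [Set.mem_ofPred_eq] at hu hv ⊢
    rw [add_pow_char_pow, add_mul, add_mul, hu, hv]
  smul_mem' k u hu := by
    simp only [Set.mem_ofPred_eq] at hu ⊢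
    rw [smul_pow, ZMod.pow_card_pow, smul_mul_assoc, smul_mul_assoc, hu]

/-- `F` is the finite field `F_{2^m}` with `m = 2r`, viewed as a vector space over
`F_2 = ZMod 2`; `Tr` is the absolute trace, `π y = y ^ (2^t + 1)`. -/
theorem stmt8 (r : ℕ) (hr : 3 ≤ r) (hodd : Odd r) (t : ℕ) (ht : 1 ≤ t)
    (hgcd : Nat.gcd t (2 * r) = 2)
    (F : Type) [Field F] [Fintype F] [Algebra (ZMod 2) F]
    (hcard : Fintype.card F = 2 ^ (2 * r))
    (π : F → F) (hπ : ∀ y, π y = y ^ (2 ^ t + 1))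
    (Tr : F → F) (hTr : ∀ x, Tr x = ∑ i ∈ Finset.range (2 * r), x ^ (2 ^ i)) :
    Function.Bijective π ∧
    (∀ S : Submodule (ZMod 2) F,
      (∀ a ∈ S, ∀ b ∈ S, ∀ y, π y + π (y + a) + π (y + b) + π (y + a + b) = 0) →
      Module.finrank (ZMod 2) ↥S ≤ 2) ∧
    (∀ S : Submodule (ZMod 2) F,
      1 ≤ Module.finrank (ZMod 2) ↥S →
      (∀ a ∈ S, ∀ b ∈ S, ∀ y, π y + π (y + a) + π (y + b) + π (y + a + b) = 0) →
      ¬ ∃ u : Fin (2 * r - Module.finrank (ZMod 2) ↥S) → F,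
        LinearIndependent (ZMod 2) u ∧
          ∀ i, ∀ a ∈ S, ∀ y, Tr (u i * (π (y + a) + π y)) = 0) := by
  have : CharP F 2 := charP_of_injective_algebraMap (algebraMap (ZMod 2) F).injective 2
  have h2 : (2 : F) = 0 := CharTwo.two_eq_zero
  have hfin : Module.finrank (ZMod 2) F = 2 * r := by
    have h := Module.card_eq_pow_finrank (K := ZMod 2) (V := F)
    rw [hcard, ZMod.card] at h
    exact (Nat.pow_right_injective le_rfl h).symm
  have hTr' (x : F) (hx : Tr x = 0) : Algebra.trace (ZMod 2) F x = 0 := by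
    apply (algebraMap (ZMod 2) F).injective
    rw [FiniteField.algebraMap_trace_eq_sum_pow, hfin, Nat.card_zmod, ← hTr, hx, map_zero]
  have hdim (S : Submodule (ZMod 2) F)
      (hS : ∀ a ∈ S, ∀ b ∈ S, ∀ y, π y + π (y + a) + π (y + b) + π (y + a + b) = 0) :
      Module.finrank (ZMod 2) ↥S ≤ 2 := by
    refine finrank_le_two_of_mul_pow_comm hcard hgcd S fun a ha b hb => ?_
    have h := hS a ha b hb 0
    simp only [hπ, zero_add, zero_pow (Nat.succ_ne_zero _), pow_succ, add_pow_char_pow] at h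
    linear_combination h - (a ^ 2 ^ t * a + b ^ 2 ^ t * b + b * a ^ 2 ^ t) * h2
  refine ⟨?_, hdim, ?_⟩
  · rw [← Finite.injective_iff_bijective, funext hπ]
    exact pow_two_pow_add_one_injective hodd hgcd hcard
  · rintro S hS1 hS ⟨u, hu, hu0⟩
    have hS2 := hdim S hS
    have hbot : S ≠ ⊥ := by
      rintro rfl
      simp at hS1
    obtain ⟨a, ha, ha0⟩ := S.exists_mem_ne_zero_of_ne_bot hbot
    let K := powMulEqSubmodule t ((a ^ 2 ^ t) ^ 2 ^ t) a
    have huK (i) : u i ∈ K :=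
      pow_mul_pow_eq_of_trace_eq_zero fun y => hTr' _ (by simpa only [hπ] using hu0 i a ha y)
    have hK : Module.finrank (ZMod 2) K ≤ 2 := by
      refine finrank_le_two_of_mul_pow_comm hcard hgcd K fun v hv w hw => ?_
      have hv' : v ^ 2 ^ t * (a ^ 2 ^ t) ^ 2 ^ t = v * a := hv
      have hw' : w ^ 2 ^ t * (a ^ 2 ^ t) ^ 2 ^ t = w * a := hw
      refine mul_right_cancel₀ (pow_ne_zero (2 ^ t) (pow_ne_zero (2 ^ t) ha0)) ?_
      linear_combination v * hw' - w * hv'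
    have hspan : Submodule.span (ZMod 2) (Set.range u) ≤ K :=
      Submodule.span_le.2 (Set.range_subset_iff.2 huK)
    have hle := Submodule.finrank_mono hspan
    rw [finrank_span_eq_card hu, Fintype.card_fin] at hle
    omega
end

section
/- Let n = 2m be even, let f1, f2, f3, f4 be Boolean functions in n variables (not necessarily bent), and let f = f1||f2||f3||f4 be their concatenation, a Boolean function in n+2 variables. If W is an (m+1)-dimensional M-subspace of f, then there exists an (m−1)-dimensional subspace V of F_2^n such that: (1) V × {(0,0)} ⊆ W, and (2) V is an M-subspace of f_i for every i = 1, 2, 3, 4. -/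
open scoped BigOperators

/-- The bent 4-concatenation `f = f1 || f2 || f3 || f4`:
`f (x, y1, y2) = f1 x + y1 (f1 x + f3 x) + y2 (f1 x + f2 x)
  + y1 y2 (f1 x + f2 x + f3 x + f4 x)`. -/
def concat {X : Type} (f1 f2 f3 f4 : X → ZMod 2) :
    X × (ZMod 2 × ZMod 2) → ZMod 2 :=
  fun p =>
    f1 p.1 + p.2.1 * (f1 p.1 + f3 p.1) + p.2.2 * (f1 p.1 + f2 p.1)
      + p.2.1 * p.2.2 * (f1 p.1 + f2 p.1 + f3 p.1 + f4 p.1)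

lemma Submodule.exists_le_finrank_eq_of_le {K E : Type*} [DivisionRing K] [AddCommGroup E]
    [Module K E] (U : Submodule K E) {d : ℕ} (hd : d ≤ Module.finrank K U) :
    ∃ V ≤ U, Module.finrank K V = d := by
  obtain ⟨v, hv⟩ := exists_linearIndependent_of_le_finrank hd
  refine ⟨Submodule.span K (Set.range fun i => (v i : E)), ?_, ?_⟩
  · rw [Submodule.span_le]
    rintro _ ⟨i, rfl⟩
    exact (v i).2
  · exact (finrank_span_eq_card (hv.map' U.subtype U.ker_subtype)).trans (Fintype.card_fin d)

lemma Submodule.finrank_le_finrank_comap_inl_add {K E F : Type*} [DivisionRing K]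
    [AddCommGroup E] [Module K E] [AddCommGroup F] [Module K F] [FiniteDimensional K E]
    [FiniteDimensional K F] (W : Submodule K (E × F)) :
    Module.finrank K W
      ≤ Module.finrank K (W.comap (LinearMap.inl K E F)) + Module.finrank K F := by
  let g : W →ₗ[K] F := LinearMap.snd K E F ∘ₗ W.subtype
  let h : LinearMap.ker g →ₗ[K] W.comap (LinearMap.inl K E F) :=
    (LinearMap.fst K E F ∘ₗ W.subtype ∘ₗ (LinearMap.ker g).subtype).codRestrict _ (by
      rintro ⟨⟨⟨x, y⟩, hw⟩, hy⟩
      obtain rfl : y = 0 := hy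
      exact hw)
  have hinj : Function.Injective h := by
    rintro ⟨⟨⟨x, y⟩, hw⟩, hy⟩ ⟨⟨⟨x', y'⟩, hw'⟩, hy'⟩ hxx
    obtain rfl : y = 0 := hy
    obtain rfl : y' = 0 := hy'
    obtain rfl : x = x' := congrArg Subtype.val hxx
    rfl
  have hrank := g.finrank_range_add_finrank_ker
  have hker := LinearMap.finrank_le_finrank_of_injective hinj
  have hrange := (LinearMap.range g).finrank_le
  omega

lemma IsMSub.of_prod {M N : Type} [AddCommGroup M] [Module (ZMod 2) M] [AddCommGroup N]
    [Module (ZMod 2) N] {f : M × N → ZMod 2} {W : Submodule (ZMod 2) (M × N)} (hW : IsMSub f W)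
    {V : Submodule (ZMod 2) M} (hV : V ≤ W.comap (LinearMap.inl (ZMod 2) M N)) (y : N) :
    IsMSub (fun x => f (x, y)) V := by
  intro a ha b hb x
  simpa using hW (a, 0) (hV ha) (b, 0) (hV hb) (x, y)

section concat

variable {X : Type} (f1 f2 f3 f4 : X → ZMod 2) (x : X)

lemma concat_zero_zero : concat f1 f2 f3 f4 (x, (0, 0)) = f1 x := by
  simp [concat]

lemma concat_zero_one : concat f1 f2 f3 f4 (x, (0, 1)) = f2 x := by
  simp only [concat]
  grind

lemma concat_one_zero : concat f1 f2 f3 f4 (x, (1, 0)) = f3 x := by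
  simp only [concat]
  grind

lemma concat_one_one : concat f1 f2 f3 f4 (x, (1, 1)) = f4 x := by
  simp only [concat]
  grind

end concat

theorem stmt11 {n m : ℕ} (hnm : n = 2 * m)
    (f1 f2 f3 f4 : BV n → ZMod 2)
    (W : Submodule (ZMod 2) (BV n × (ZMod 2 × ZMod 2)))
    (hWdim : Module.finrank (ZMod 2) ↥W = m + 1)
    (hWM : IsMSub (concat f1 f2 f3 f4) W) :
    ∃ V : Submodule (ZMod 2) (BV n),
      Module.finrank (ZMod 2) ↥V = m - 1 ∧
      (∀ v ∈ V, ((v, ((0 : ZMod 2), (0 : ZMod 2))) : BV n × (ZMod 2 × ZMod 2)) ∈ W) ∧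
      IsMSub f1 V ∧ IsMSub f2 V ∧ IsMSub f3 V ∧ IsMSub f4 V := by
  obtain ⟨V, hVW, hV⟩ := Submodule.exists_le_finrank_eq_of_le (d := m - 1)
    (W.comap (LinearMap.inl (ZMod 2) (BV n) (ZMod 2 × ZMod 2))) (by
      have h := W.finrank_le_finrank_comap_inl_add
      rw [Module.finrank_prod, Module.finrank_self] at h
      omega)
  have h := hWM.of_prod hVW
  refine ⟨V, hV, fun v hv => hVW hv, ?_, ?_, ?_, ?_⟩
  · simpa only [concat_zero_zero] using h (0, 0)
  · simpa only [concat_zero_one] using h (0, 1)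
  · simpa only [concat_one_zero] using h (1, 0)
  · simpa only [concat_one_one] using h (1, 1)
end

section
/- Let n = 2m and let f1, f2, f3, f4 be Maiorana–McFarland bent functions on F_2^m × F_2^m, i.e., f_i(x,y) = x·π_i(y) + h_i(y) for permutations π_i of F_2^m and Boolean functions h_i on F_2^m, such that for each i the unique m-dimensional M-subspace of f_i is U = F_2^m × {0}. Let f = f1||f2||f3||f4 on F_2^{2m} × F_2 × F_2. Then every (m+1)-dimensional M-subspace W of f has one of the following forms: (i) W = span(U × {(0,0)} ∪ {(a,b,c1,c2)}) for some a, b ∈ F_2^m and (c1,c2) ∈ F_2^2 with (c1,c2) ≠ (0,0); or (ii) W = span(V × {(0,0)} ∪ {(a,b,c1,c2), (e,g,d1,d2)}) for some (m−1)-dimensional subspace V of F_2^{2m}, vectors a, b, e, g ∈ F_2^m and pairs (c1,c2), (d1,d2) ∈ F_2^2 with (c1,c2) ≠ (0,0), (d1,d2) ≠ (0,0) and (c1,c2) ≠ (d1,d2). -/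
open scoped BigOperators

/-- Rank-nullity for the second projection of a subspace of a product. -/
theorem finrank_comap_inl_add_finrank_map_snd {K E F : Type*} [Field K]
    [AddCommGroup E] [Module K E] [AddCommGroup F] [Module K F]
    [FiniteDimensional K E] [FiniteDimensional K F] (W : Submodule K (E × F)) :
    Module.finrank K (W.comap (LinearMap.inl K E F)) +
      Module.finrank K (W.map (LinearMap.snd K E F)) = Module.finrank K W := by
  have h := LinearMap.finrank_range_add_finrank_ker ((LinearMap.snd K E F).domRestrict W)
  rw [LinearMap.range_domRestrict] at h
  rw [← h, add_comm]
  congr 1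
  refine LinearEquiv.finrank_eq
    { toFun := fun v => ⟨⟨(v.1, 0), v.2⟩, rfl⟩
      map_add' := fun u v => by ext <;> simp
      map_smul' := fun c v => by ext <;> simp
      invFun := fun w => ⟨w.1.1.1, ?_⟩
      left_inv := fun v => rfl
      right_inv := ?_ }
  · obtain ⟨⟨⟨x, y⟩, hw⟩, hy⟩ := w
    obtain rfl : y = 0 := hy
    exact hw
  · rintro ⟨⟨⟨x, y⟩, hw⟩, hy⟩
    obtain rfl : y = 0 := hy
    rfl

/-- A subspace of a product is generated by its part over `0` together with any subset whose
second components generate its second projection. -/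
theorem eq_prod_bot_sup_span {K E F : Type*} [Field K]
    [AddCommGroup E] [Module K E] [AddCommGroup F] [Module K F]
    (W : Submodule K (E × F)) (S : Set (E × F)) (hS : S ⊆ W)
    (h : W.map (LinearMap.snd K E F) ≤ (Submodule.span K S).map (LinearMap.snd K E F)) :
    W = (W.comap (LinearMap.inl K E F)).prod ⊥ ⊔ Submodule.span K S := by
  have hSW : Submodule.span K S ≤ W := Submodule.span_le.2 hS
  refine le_antisymm (fun w hw => ?_) (sup_le ?_ hSW)
  · obtain ⟨s, hs, hsw⟩ := h (Submodule.mem_map_of_mem hw)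
    have hsw' : w.2 - s.2 = 0 := sub_eq_zero.2 hsw.symm
    refine Submodule.mem_sup.2 ⟨w - s, ⟨?_, hsw'⟩, s, hs, sub_add_cancel w s⟩
    have hmem := W.sub_mem hw (hSW hs)
    rwa [show w - s = ((w - s).1, 0) from Prod.ext rfl hsw'] at hmem
  · rintro ⟨x, y⟩ ⟨hx, hy⟩
    obtain rfl : y = 0 := hy
    exact hx

/-- Between two nested subspaces there is one of every intermediate dimension. -/
theorem exists_intermediate_finrank_eq {K E : Type*} [Field K] [AddCommGroup E] [Module K E]
    [FiniteDimensional K E] {S V : Submodule K E} (hSV : S ≤ V) {d : ℕ}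
    (hSd : Module.finrank K S ≤ d) (hdV : d ≤ Module.finrank K V) :
    ∃ T, S ≤ T ∧ T ≤ V ∧ Module.finrank K T = d := by
  induction d, hSd using Nat.le_induction with
  | base => exact ⟨S, le_rfl, hSV, rfl⟩
  | succ d _ ih =>
    obtain ⟨T, hST, hTV, rfl⟩ := ih (by omega)
    have hVT : ¬ V ≤ T := fun h => by
      have := Submodule.finrank_mono h
      omega
    obtain ⟨w, hwV, hwT⟩ := SetLike.not_le_iff_exists.1 hVT
    exact ⟨T ⊔ Submodule.span K {w}, hST.trans le_sup_left,
      sup_le hTV ((Submodule.span_singleton_le_iff_mem _ _).2 hwV),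
      Submodule.finrank_sup_span_singleton hwT⟩

/-- If `U` is the only `d`-dimensional M-subspace of `f`, then `f` has no M-subspace of
larger dimension. -/
theorem IsMSub.finrank_le_of_unique {M : Type} [AddCommGroup M] [Module (ZMod 2) M]
    [FiniteDimensional (ZMod 2) M] {f : M → ZMod 2} {U V : Submodule (ZMod 2) M} {d : ℕ}
    (hd : 1 ≤ d) (hUd : Module.finrank (ZMod 2) U ≤ d)
    (hU : ∀ W : Submodule (ZMod 2) M, Module.finrank (ZMod 2) W = d → IsMSub f W → W = U)
    (hV : IsMSub f V) : Module.finrank (ZMod 2) V ≤ d := by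
  by_contra! hlt
  have hVU : ¬ V ≤ U := fun h => by
    have := Submodule.finrank_mono h
    omega
  obtain ⟨v, hvV, hvU⟩ := SetLike.not_le_iff_exists.1 hVU
  have hv : Module.finrank (ZMod 2) (Submodule.span (ZMod 2) {v}) ≤ d :=
    (finrank_span_singleton (ne_of_mem_of_not_mem U.zero_mem hvU).symm).trans_le hd
  obtain ⟨T, hvT, hTV, hTd⟩ := exists_intermediate_finrank_eq
    ((Submodule.span_singleton_le_iff_mem _ _).2 hvV) hv hlt.le
  have hTU := hU T hTd fun a ha b hb => hV a (hTV ha) b (hTV hb)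
  exact hvU (hTU ▸ hvT (Submodule.mem_span_singleton_self v))

theorem stmt12 {m : ℕ}
    (π1 π2 π3 π4 : BV m → BV m)
    (hπ1 : Function.Bijective π1) (hπ2 : Function.Bijective π2)
    (hπ3 : Function.Bijective π3) (hπ4 : Function.Bijective π4)
    (h1 h2 h3 h4 : BV m → ZMod 2)
    (f1 f2 f3 f4 : BV m × BV m → ZMod 2)
    (hf1 : ∀ x y, f1 (x, y) = dotp x (π1 y) + h1 y)
    (hf2 : ∀ x y, f2 (x, y) = dotp x (π2 y) + h2 y)
    (hf3 : ∀ x y, f3 (x, y) = dotp x (π3 y) + h3 y)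
    (hf4 : ∀ x y, f4 (x, y) = dotp x (π4 y) + h4 y)
    (U : Submodule (ZMod 2) (BV m × BV m))
    (hU : U = (⊤ : Submodule (ZMod 2) (BV m)).prod (⊥ : Submodule (ZMod 2) (BV m)))
    (hU1 : IsMSub f1 U ∧ ∀ W : Submodule (ZMod 2) (BV m × BV m),
      Module.finrank (ZMod 2) ↥W = m → IsMSub f1 W → W = U)
    (hU2 : IsMSub f2 U ∧ ∀ W : Submodule (ZMod 2) (BV m × BV m),
      Module.finrank (ZMod 2) ↥W = m → IsMSub f2 W → W = U)
    (hU3 : IsMSub f3 U ∧ ∀ W : Submodule (ZMod 2) (BV m × BV m),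
      Module.finrank (ZMod 2) ↥W = m → IsMSub f3 W → W = U)
    (hU4 : IsMSub f4 U ∧ ∀ W : Submodule (ZMod 2) (BV m × BV m),
      Module.finrank (ZMod 2) ↥W = m → IsMSub f4 W → W = U)
    (W : Submodule (ZMod 2) ((BV m × BV m) × (ZMod 2 × ZMod 2)))
    (hWdim : Module.finrank (ZMod 2) ↥W = m + 1)
    (hWM : IsMSub (concat f1 f2 f3 f4) W) :
    (∃ a b : BV m, ∃ c1 c2 : ZMod 2, (c1, c2) ≠ ((0 : ZMod 2), (0 : ZMod 2)) ∧
      W = (U.prod (⊥ : Submodule (ZMod 2) (ZMod 2 × ZMod 2))) ⊔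
        Submodule.span (ZMod 2) {(((a, b), (c1, c2)) : (BV m × BV m) × (ZMod 2 × ZMod 2))}) ∨
    (∃ V : Submodule (ZMod 2) (BV m × BV m), Module.finrank (ZMod 2) ↥V = m - 1 ∧
      ∃ a b e g : BV m, ∃ c1 c2 d1 d2 : ZMod 2,
        (c1, c2) ≠ ((0 : ZMod 2), (0 : ZMod 2)) ∧
        (d1, d2) ≠ ((0 : ZMod 2), (0 : ZMod 2)) ∧ (c1, c2) ≠ (d1, d2) ∧
        W = (V.prod (⊥ : Submodule (ZMod 2) (ZMod 2 × ZMod 2))) ⊔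
          Submodule.span (ZMod 2)
            {(((a, b), (c1, c2)) : (BV m × BV m) × (ZMod 2 × ZMod 2)),
             (((e, g), (d1, d2)) : (BV m × BV m) × (ZMod 2 × ZMod 2))}) := by
  have hW0 : IsMSub f1 (W.comap (LinearMap.inl _ _ _)) := fun a ha b hb x => by
    simpa [concat] using hWM _ ha _ hb (x, 0)
  have hrank := finrank_comap_inl_add_finrank_map_snd W
  have hUd : Module.finrank (ZMod 2) U ≤ m := by
    rw [hU, ← Submodule.map_inl]
    exact (Submodule.finrank_map_le _ _).trans (by simp)
  have hle : Module.finrank (ZMod 2) (W.comap (LinearMap.inl _ _ _)) ≤ m := by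
    rcases Nat.eq_zero_or_pos m with rfl | hm
    · exact (Submodule.finrank_le _).trans (by simp)
    · exact hW0.finrank_le_of_unique hm hUd hU1.2
  have hsnd := Submodule.finrank_le (W.map (LinearMap.snd _ _ _))
  have h2 : Module.finrank (ZMod 2) (ZMod 2 × ZMod 2) = 2 := by simp
  obtain hone | htwo : Module.finrank (ZMod 2) (W.map (LinearMap.snd _ _ _)) = 1 ∨
      Module.finrank (ZMod 2) (W.map (LinearMap.snd _ _ _)) = 2 := by omega
  · left
    obtain ⟨⟨_, ⟨⟨⟨a, b⟩, c1, c2⟩, hw, rfl⟩⟩, hne, hspan⟩ := finrank_eq_one_iff'.1 hone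
    refine ⟨a, b, c1, c2, fun h => hne (Subtype.ext h), ?_⟩
    rw [← hU1.2 _ (by omega) hW0]
    refine eq_prod_bot_sup_span W _ (Set.singleton_subset_iff.2 hw) fun y hy => ?_
    obtain ⟨c, hc⟩ := hspan ⟨y, hy⟩
    exact ⟨_, Submodule.smul_mem _ c (Submodule.mem_span_singleton_self _),
      congrArg Subtype.val hc⟩
  · right
    have htop := Submodule.eq_top_of_finrank_eq (htwo.trans h2.symm)
    obtain ⟨⟨⟨a, b⟩, p⟩, hw1, hp⟩ :=
      htop.ge (Submodule.mem_top (x := ((1, 0) : ZMod 2 × ZMod 2)))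
    obtain ⟨⟨⟨e, g⟩, q⟩, hw2, hq⟩ :=
      htop.ge (Submodule.mem_top (x := ((0, 1) : ZMod 2 × ZMod 2)))
    obtain rfl : p = (1, 0) := hp
    obtain rfl : q = (0, 1) := hq
    refine ⟨_, by omega, a, b, e, g, 1, 0, 0, 1, by decide, by decide, by decide,
      eq_prod_bot_sup_span W _ (Set.pair_subset hw1 hw2) fun y _ => ?_⟩
    refine ⟨y.1 • ((a, b), (1, 0)) + y.2 • ((e, g), (0, 1)), Submodule.add_mem _
      (Submodule.smul_mem _ _ (Submodule.subset_span (by simp)))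
      (Submodule.smul_mem _ _ (Submodule.subset_span (by simp))), ?_⟩
    ext <;> simp
end
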